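/- There exists a constant c > 0 such that for every binary matrix M ∈ {0,1}^{m×n} with rank(M) ≤ r and density p = |M|/(mn) ≤ 1/2, the discrepancy satisfies disc(M) ≥ c·mn·min{p, p^{1/2}/√r}. -/

import Mathlib

open Finset

/-- Number of 1 entries of the submatrix of `M` with rows `X` and columns `Y`
(for a 0/1 matrix this is just the sum of its entries). -/
noncomputable def ones {m n : ℕ} (M : Matrix (Fin m) (Fin n) ℝ)
    (X : Finset (Fin m)) (Y : Finset (Fin n)) : ℝ :=
  ∑ i ∈ X, ∑ j ∈ Y, M i j

/-- The density `p = |M|/(mn)`. -/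
noncomputable def dens {m n : ℕ} (M : Matrix (Fin m) (Fin n) ℝ) : ℝ :=
  ones M univ univ / (m * n)

/-- `disc(X,Y) = |M[X×Y]| - p|X||Y|`. -/
noncomputable def disc {m n : ℕ} (M : Matrix (Fin m) (Fin n) ℝ)
    (X : Finset (Fin m)) (Y : Finset (Fin n)) : ℝ :=
  ones M X Y - dens M * X.card * Y.card

/-- Positive discrepancy `disc⁺(M) = max_{X,Y} disc(X,Y)`. -/
noncomputable def discP {m n : ℕ} (M : Matrix (Fin m) (Fin n) ℝ) : ℝ :=
  sup' univ ⟨(∅, ∅), mem_univ _⟩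
    (fun XY : Finset (Fin m) × Finset (Fin n) => disc M XY.1 XY.2)

/-- Negative discrepancy `disc⁻(M) = max_{X,Y} (-disc(X,Y))`. -/
noncomputable def discN {m n : ℕ} (M : Matrix (Fin m) (Fin n) ℝ) : ℝ :=
  sup' univ ⟨(∅, ∅), mem_univ _⟩
    (fun XY : Finset (Fin m) × Finset (Fin n) => -disc M XY.1 XY.2)

/-- `HilbertBilinearBound B G` says that `∑ B i j ⟪u i, v j⟫ ≤ G` for all families of vectors
`u`, `v` in the Euclidean unit ball of any finite dimension. -/
def HilbertBilinearBound {I J : Type} [Fintype I] [Fintype J] (B : I → J → ℝ) (G : ℝ) : Prop :=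
  ∀ (ι : Type) [Fintype ι] (u : I → ι → ℝ) (v : J → ι → ℝ),
    (∀ i, ∑ k, u i k ^ 2 ≤ 1) → (∀ j, ∑ k, v j k ^ 2 ≤ 1) →
      ∑ i, ∑ j, B i j * ∑ k, u i k * v j k ≤ G

/-- Rademacher variables on a finite probability space: the second moments are orthonormal and
the fourth moments satisfy Khintchine's inequality. -/
theorem exists_rademacher_fin (d : ℕ) :
    ∃ (Ω : Type) (_ : Fintype Ω) (_ : Nonempty Ω) (g : Fin d → Ω → ℝ),
      (∀ u v : Fin d → ℝ, ∑ ω, (∑ k, u k * g k ω) * (∑ k, v k * g k ω) =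
        Fintype.card Ω * ∑ k, u k * v k) ∧
      (∀ u : Fin d → ℝ, ∑ ω, (∑ k, u k * g k ω) ^ 4 ≤
        3 * Fintype.card Ω * (∑ k, u k ^ 2) ^ 2) := by
  induction d with
  | zero => exact ⟨Unit, inferInstance, inferInstance, fun _ _ => 0, by simp, by simp⟩
  | succ d ih =>
    obtain ⟨Ω, _, _, g, h2, h4⟩ := ih
    refine ⟨Ω × Bool, inferInstance, inferInstance,
      fun k ω => Fin.cases (if ω.2 then 1 else -1) (fun k => g k ω.1) k, ?_, ?_⟩
    · intro u v
      simp only [Fintype.sum_prod_type, Fin.sum_univ_succ, Fin.cases_zero, Fin.cases_succ,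
        Fintype.sum_bool, Fintype.card_prod, Fintype.card_bool]
      have := h2 (fun k => u k.succ) (fun k => v k.succ)
      calc _ = ∑ ω, (2 * (u 0 * v 0) +
            2 * ((∑ k : Fin d, u k.succ * g k ω) * (∑ k : Fin d, v k.succ * g k ω))) := by
            refine sum_congr rfl fun ω _ => ?_
            simp
            ring
        _ = _ := by
            rw [sum_add_distrib, ← mul_sum _ _ (2 : ℝ), ← mul_sum _ _ (2 : ℝ), this]
            simp
            ring
    · intro u
      simp only [Fintype.sum_prod_type, Fin.sum_univ_succ, Fin.cases_zero, Fin.cases_succ,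
        Fintype.sum_bool, Fintype.card_prod, Fintype.card_bool]
      have h2' := h2 (fun k => u k.succ) (fun k => u k.succ)
      have h4' := h4 (fun k => u k.succ)
      calc _ = ∑ ω, (2 * u 0 ^ 4 +
            12 * u 0 ^ 2 * ((∑ k : Fin d, u k.succ * g k ω) * (∑ k : Fin d, u k.succ * g k ω)) +
            2 * (∑ k : Fin d, u k.succ * g k ω) ^ 4) := by
            refine sum_congr rfl fun ω _ => ?_
            simp
            ring
        _ ≤ _ := by
            rw [sum_add_distrib, sum_add_distrib, ← mul_sum, ← mul_sum, ← mul_sum, h2']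
            simp only [sum_const, card_univ, nsmul_eq_mul, ← pow_two]
            push_cast
            have : 0 ≤ (Fintype.card Ω : ℝ) * u 0 ^ 4 := by positivity
            nlinarith

theorem exists_rademacher (ι : Type) [Fintype ι] :
    ∃ (Ω : Type) (_ : Fintype Ω) (_ : Nonempty Ω) (g : ι → Ω → ℝ),
      (∀ u v : ι → ℝ, ∑ ω, (∑ k, u k * g k ω) * (∑ k, v k * g k ω) =
        Fintype.card Ω * ∑ k, u k * v k) ∧
      (∀ u : ι → ℝ, ∑ ω, (∑ k, u k * g k ω) ^ 4 ≤
        3 * Fintype.card Ω * (∑ k, u k ^ 2) ^ 2) := by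
  obtain ⟨Ω, i1, i2, g, h2, h4⟩ := exists_rademacher_fin (Fintype.card ι)
  let e := Fintype.equivFin ι
  have key (f : ι → ℝ) : ∑ k, f k = ∑ k, f (e.symm k) := (Equiv.sum_comp e.symm f).symm
  refine ⟨Ω, i1, i2, fun k => g (e k), fun u v => ?_, fun u => ?_⟩
  · simpa [key] using h2 (fun k => u (e.symm k)) (fun k => v (e.symm k))
  · simpa [key] using h4 (fun k => u (e.symm k))

/-- Truncation of a real number to `[-2, 2]`. -/
noncomputable def trunc (x : ℝ) : ℝ := max (-2) (min x 2)

theorem abs_trunc_le (x : ℝ) : |trunc x| ≤ 2 := by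
  unfold trunc
  grind

theorem trunc_sq_le (x : ℝ) : trunc x ^ 2 ≤ x ^ 2 := by
  apply sq_le_sq.mpr
  unfold trunc
  grind

theorem sub_trunc_sq_le (x : ℝ) : (x - trunc x) ^ 2 ≤ x ^ 4 / 64 := by
  have h : |x - trunc x| ≤ |x ^ 2 / 8| := by
    rw [abs_of_nonneg (a := x ^ 2 / 8) (by positivity), abs_le]
    have h1 := sq_nonneg (x - 4)
    have h2 := sq_nonneg (x + 4)
    have h3 := sq_nonneg x
    unfold trunc
    rcases le_total x 2 with a | a <;> rcases le_total (-2) x with b | b <;>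
      simp [a, b] <;> (try constructor) <;> nlinarith
  calc _ ≤ (x ^ 2 / 8) ^ 2 := sq_le_sq.mpr h
    _ = _ := by ring

section
variable {I J : Type} [Fintype I] [Fintype J] {B : I → J → ℝ}

theorem HilbertBilinearBound.sum_abs (B : I → J → ℝ) :
    HilbertBilinearBound B (∑ i, ∑ j, |B i j|) := by
  intro ι _ u v hu hv
  refine sum_le_sum fun i _ => sum_le_sum fun j _ => ?_
  have h : |∑ k, u i k * v j k| ≤ 1 := by
    rw [← sq_le_one_iff_abs_le_one]
    calc _ ≤ (∑ k, u i k ^ 2) * ∑ k, v j k ^ 2 := sum_mul_sq_le_sq_mul_sq _ _ _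
      _ ≤ 1 * 1 := mul_le_mul (hu i) (hv j) (sum_nonneg fun _ _ => sq_nonneg _) zero_le_one
      _ = 1 := one_mul 1
  calc _ ≤ |B i j * ∑ k, u i k * v j k| := le_abs_self _
    _ = |B i j| * |∑ k, u i k * v j k| := abs_mul _ _
    _ ≤ |B i j| * 1 := by gcongr
    _ = _ := mul_one _

theorem HilbertBilinearBound.scaled {G : ℝ} (h : HilbertBilinearBound B G) {ι : Type} [Fintype ι]
    {u : I → ι → ℝ} {v : J → ι → ℝ} {α β : ℝ} (hα : 0 < α) (hβ : 0 < β)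
    (hu : ∀ i, ∑ k, u i k ^ 2 ≤ α ^ 2) (hv : ∀ j, ∑ k, v j k ^ 2 ≤ β ^ 2) :
    ∑ i, ∑ j, B i j * ∑ k, u i k * v j k ≤ α * β * G := by
  have := h ι (fun i k => u i k / α) (fun j k => v j k / β)
    (fun i => by
      simp only [div_pow, ← sum_div]
      exact (div_le_one (by positivity)).mpr (hu i))
    (fun j => by
      simp only [div_pow, ← sum_div]
      exact (div_le_one (by positivity)).mpr (hv j))
  rw [mul_comm, ← div_le_iff₀ (by positivity)]
  refine le_trans (le_of_eq ?_) this
  simp only [sum_div, mul_sum]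
  refine sum_congr rfl fun i _ => sum_congr rfl fun j _ => sum_congr rfl fun k _ => ?_
  field_simp

theorem HilbertBilinearBound.improve {S G : ℝ}
    (hS : ∀ (x : I → ℝ) (y : J → ℝ), (∀ i, |x i| ≤ 1) → (∀ j, |y j| ≤ 1) →
      ∑ i, ∑ j, B i j * (x i * y j) ≤ S)
    (h : HilbertBilinearBound B G) : HilbertBilinearBound B (4 * S + G / 2) := by
  intro ι _ u v hu hv
  obtain ⟨Ω, _, _, g, h2, h4⟩ := exists_rademacher ι
  set U : I → Ω → ℝ := fun i ω => ∑ k, u i k * g k ω with hU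
  set V : J → Ω → ℝ := fun j ω => ∑ k, v j k * g k ω with hV
  set N : ℝ := (Fintype.card Ω : ℝ) with hN
  have hN0 : 0 < N := by simpa [hN] using Fintype.card_pos (α := Ω)
  have second (w : ι → ℝ) (hw : ∑ k, w k ^ 2 ≤ 1) :
      ∑ ω, (∑ k, w k * g k ω) ^ 2 ≤ √N ^ 2 := by
    have := h2 w w
    simp only [← pow_two] at this
    rw [this, Real.sq_sqrt hN0.le]
    nlinarith
  have fourth (w : ι → ℝ) (hw : ∑ k, w k ^ 2 ≤ 1) :
      ∑ ω, ((∑ k, w k * g k ω) - trunc (∑ k, w k * g k ω)) ^ 2 ≤ (√N / 4) ^ 2 := by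
    calc _ ≤ ∑ ω, (∑ k, w k * g k ω) ^ 4 / 64 := sum_le_sum fun _ _ => sub_trunc_sq_le _
      _ ≤ (3 * N * (∑ k, w k ^ 2) ^ 2) / 64 := by
        rw [← sum_div]
        have := h4 w
        gcongr
      _ ≤ (3 * N * 1 ^ 2) / 64 := by
        have : 0 ≤ ∑ k, w k ^ 2 := sum_nonneg fun _ _ => sq_nonneg _
        gcongr
      _ ≤ _ := by
        rw [div_pow, Real.sq_sqrt hN0.le]
        linarith
  have e1 : ∑ i, ∑ j, B i j * ∑ ω, (U i ω - trunc (U i ω)) * trunc (V j ω) ≤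
      √N / 4 * √N * G :=
    h.scaled (by positivity) (by positivity) (fun i => fourth _ (hu i))
      (fun j => (sum_le_sum fun _ _ => trunc_sq_le _).trans (second _ (hv j)))
  have e2 : ∑ i, ∑ j, B i j * ∑ ω, U i ω * (V j ω - trunc (V j ω)) ≤
      √N * (√N / 4) * G :=
    h.scaled (by positivity) (by positivity) (fun i => second _ (hu i))
      (fun j => fourth _ (hv j))
  have e3 : ∑ i, ∑ j, B i j * ∑ ω, trunc (U i ω) * trunc (V j ω) ≤ N * (4 * S) := by
    calc _ = ∑ ω, 4 * ∑ i, ∑ j, B i j * ((trunc (U i ω) / 2) * (trunc (V j ω) / 2)) := by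
          simp only [mul_sum]
          rw [sum_comm (γ := Ω)]
          refine sum_congr rfl fun i _ => ?_
          rw [sum_comm (γ := Ω)]
          refine sum_congr rfl fun j _ => sum_congr rfl fun ω _ => ?_
          ring
      _ ≤ ∑ _ω : Ω, 4 * S := by
          refine sum_le_sum fun ω _ => ?_
          have hb (x : ℝ) : |trunc x / 2| ≤ 1 := by
            rw [abs_div, abs_two]
            linarith [abs_trunc_le x]
          have := hS (fun i => trunc (U i ω) / 2) (fun j => trunc (V j ω) / 2)
            (fun _ => hb _) (fun _ => hb _)
          linarith
      _ = _ := by simp [hN]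
  have hsum : N * ∑ i, ∑ j, B i j * ∑ k, u i k * v j k =
      (∑ i, ∑ j, B i j * ∑ ω, trunc (U i ω) * trunc (V j ω)) +
      (∑ i, ∑ j, B i j * ∑ ω, (U i ω - trunc (U i ω)) * trunc (V j ω)) +
      ∑ i, ∑ j, B i j * ∑ ω, U i ω * (V j ω - trunc (V j ω)) := by
    simp only [mul_sum (s := univ (α := I)), mul_sum (s := univ (α := J)), ← sum_add_distrib]
    refine sum_congr rfl fun i _ => sum_congr rfl fun j _ => ?_
    rw [mul_left_comm, ← h2, ← mul_add, ← mul_add, ← sum_add_distrib, ← sum_add_distrib]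
    congr 1
    refine sum_congr rfl fun ω _ => ?_
    simp only [hU, hV]
    ring
  have hs : √N * √N = N := Real.mul_self_sqrt hN0.le
  refine le_of_mul_le_mul_left (a := N) ?_ hN0
  rw [hsum]
  have e1' : √N / 4 * √N * G = N * (G / 4) := by
    linear_combination G / 4 * hs
  have e2' : √N * (√N / 4) * G = N * (G / 4) := by
    linear_combination G / 4 * hs
  linarith

/-- Grothendieck's inequality with constant `8`. -/
theorem hilbertBilinearBound_of_sign {S : ℝ}
    (hS : ∀ (x : I → ℝ) (y : J → ℝ), (∀ i, |x i| ≤ 1) → (∀ j, |y j| ≤ 1) →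
      ∑ i, ∑ j, B i j * (x i * y j) ≤ S) : HilbertBilinearBound B (8 * S) := by
  set G := ∑ i, ∑ j, |B i j|
  have step (d : ℕ) : HilbertBilinearBound B (8 * S + (G - 8 * S) * (1 / 2) ^ d) := by
    induction d with
    | zero => simpa using HilbertBilinearBound.sum_abs B
    | succ d ih =>
      convert ih.improve hS using 1
      ring
  intro ι _ u v hu hv
  have lim : Filter.Tendsto (fun d : ℕ => 8 * S + (G - 8 * S) * (1 / 2 : ℝ) ^ d) Filter.atTop
      (nhds (8 * S + (G - 8 * S) * 0)) :=
    ((tendsto_pow_atTop_nhds_zero_of_lt_one (by norm_num) (by norm_num)).const_mul _).const_add _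
  rw [mul_zero, add_zero] at lim
  exact ge_of_tendsto' lim fun d => step d ι u v hu hv
/-- Pietsch-type factorization: a bound on Hilbert space vectors yields weights dominating the
bilinear form. -/
theorem HilbertBilinearBound.exists_weights [Nonempty I] {G : ℝ} (hG : 0 < G)
    (h : HilbertBilinearBound B G) :
    ∃ (a : I → ℝ) (b : J → ℝ), (∀ i, 0 ≤ a i) ∧ (∀ j, 0 ≤ b j) ∧
      ∑ i, a i + ∑ j, b j = 1 ∧
      ∀ (x : I → ℝ) (y : J → ℝ), ∑ i, ∑ j, B i j * (x i * y j) ≤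
        G * (∑ i, a i * x i ^ 2 + ∑ j, b j * y j ^ 2) := by
  classical
  let form : (I → ℝ) → (J → ℝ) → ℝ := fun x y => ∑ i, ∑ j, B i j * (x i * y j)
  let q : (I → ℝ) × (J → ℝ) → (I ⊕ J → ℝ) := fun z =>
    Sum.elim (fun i => G * z.1 i ^ 2 - form z.1 z.2) (fun j => G * z.2 j ^ 2 - form z.1 z.2)
  let Q : Set (I ⊕ J → ℝ) := convexHull ℝ (Set.range q)
  let N : Set (I ⊕ J → ℝ) := Set.univ.pi fun _ => Set.Iio 0
  have hNconv : Convex ℝ N := convex_pi fun _ _ => convex_Iio 0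
  have hNopen : IsOpen N := isOpen_set_pi Set.finite_univ fun _ _ => isOpen_Iio
  have hdisj : Disjoint N Q := by
    rw [Set.disjoint_left]
    intro z hzN hzQ
    obtain ⟨ι, _, w, p, hw, _, hp, rfl⟩ := mem_convexHull_iff_exists_fintype.1 hzQ
    choose xy hxy using hp
    set T : ℝ := ∑ k, w k * form (xy k).1 (xy k).2 with hT
    have hI (i : I) : ∑ k, (√(w k) * (xy k).1 i) ^ 2 < T / G := by
      have h0 := hzN (Sum.inl i) (Set.mem_univ _)
      rw [lt_div_iff₀ hG]
      simp only [← hxy, q, Finset.sum_apply, Pi.smul_apply, Sum.elim_inl, smul_eq_mul, Set.mem_Iio,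
        mul_sub, sum_sub_distrib] at h0
      simp only [mul_pow, Real.sq_sqrt (hw _), sum_mul]
      have e : ∑ k, w k * (G * (xy k).1 i ^ 2) = ∑ k, w k * (xy k).1 i ^ 2 * G :=
        sum_congr rfl fun _ _ => by ring
      linarith
    have hJ (j : J) : ∑ k, (√(w k) * (xy k).2 j) ^ 2 < T / G := by
      have h0 := hzN (Sum.inr j) (Set.mem_univ _)
      rw [lt_div_iff₀ hG]
      simp only [← hxy, q, Finset.sum_apply, Pi.smul_apply, Sum.elim_inr, smul_eq_mul, Set.mem_Iio,
        mul_sub, sum_sub_distrib] at h0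
      simp only [mul_pow, Real.sq_sqrt (hw _), sum_mul]
      have e : ∑ k, w k * (G * (xy k).2 j ^ 2) = ∑ k, w k * (xy k).2 j ^ 2 * G :=
        sum_congr rfl fun _ _ => by ring
      linarith
    have i0 : I := Classical.arbitrary I
    obtain ⟨s, hs, hsT⟩ : ∃ s, 0 < s ∧ s < T / G ∧
        (∀ i, ∑ k, (√(w k) * (xy k).1 i) ^ 2 ≤ s) ∧
        ∀ j, ∑ k, (√(w k) * (xy k).2 j) ^ 2 ≤ s := by
      let f : I ⊕ J → ℝ := Sum.elim (fun i => ∑ k, (√(w k) * (xy k).1 i) ^ 2)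
        (fun j => ∑ k, (√(w k) * (xy k).2 j) ^ 2)
      obtain ⟨l, hl⟩ := Finite.exists_max f
      have hfl : f l < T / G := by
        rcases l with i | j
        · exact hI i
        · exact hJ j
      have h0 : 0 ≤ f l := (sum_nonneg fun _ _ => sq_nonneg _).trans (hl (Sum.inl i0))
      refine ⟨(f l + T / G) / 2, by linarith, by linarith, fun i => ?_, fun j => ?_⟩
      · have := hl (Sum.inl i)
        simp only [f, Sum.elim_inl] at this ⊢
        linarith
      · have := hl (Sum.inr j)
        simp only [f, Sum.elim_inr] at this ⊢
        linarith
    have hb := h.scaled (Real.sqrt_pos.2 hs) (Real.sqrt_pos.2 hs)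
      (u := fun i k => √(w k) * (xy k).1 i) (v := fun j k => √(w k) * (xy k).2 j)
      (by simpa only [Real.sq_sqrt hs.le] using hsT.2.1)
      (by simpa only [Real.sq_sqrt hs.le] using hsT.2.2)
    have e : ∑ i, ∑ j, B i j * ∑ k, √(w k) * (xy k).1 i * (√(w k) * (xy k).2 j) = T := by
      simp only [hT, form, mul_sum]
      rw [sum_comm (γ := ι)]
      refine sum_congr rfl fun i _ => ?_
      rw [sum_comm (γ := ι)]
      refine sum_congr rfl fun j _ => sum_congr rfl fun k _ => ?_
      have := Real.mul_self_sqrt (hw k)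
      linear_combination (B i j * (xy k).1 i * (xy k).2 j) * this
    rw [e, Real.mul_self_sqrt hs.le] at hb
    have := (lt_div_iff₀ hG).1 hsT.1
    linarith
  obtain ⟨f, c, hfN, hfQ⟩ := geometric_hahn_banach_open hNconv hNopen (convex_convexHull ℝ _) hdisj
  let e : I ⊕ J → ℝ := fun l => f (Pi.single l 1)
  have hf (z : I ⊕ J → ℝ) : f z = ∑ l, e l * z l := by
    conv_lhs => rw [pi_eq_sum_univ' z]
    simp [e, mul_comm]
  have hc : c ≤ 0 := by
    have := hfQ (q 0) (subset_convexHull ℝ _ ⟨0, rfl⟩)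
    have hq : q 0 = 0 := by
      ext l
      rcases l with i | j <;> simp [q, form]
    rwa [hq, map_zero] at this
  have hneg : ∑ l, e l > 0 := by
    have := hfN (fun _ => -1) (fun _ _ => by simp)
    rw [hf] at this
    simp only [mul_neg, mul_one, sum_neg_distrib] at this
    linarith
  have hc0 : 0 ≤ c := by
    by_contra! hlt
    have ht : 0 < -c / (∑ l, e l) := div_pos (by linarith) hneg
    have := hfN (fun _ => -(-c / (∑ l, e l))) (fun _ _ => by simpa using ht)
    rw [hf, ← sum_mul] at this
    field_simp at this
    linarith
  have he (l : I ⊕ J) : 0 ≤ e l := by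
    by_contra! hlt
    set t : ℝ := (∑ l, e l) / (-e l) with ht
    have ht0 : 0 < t := div_pos hneg (by linarith)
    have := hfN (fun l' => -1 - if l' = l then t else 0) (fun l' _ => by
      simp only [Set.mem_Iio]
      split_ifs <;> linarith)
    rw [hf] at this
    simp only [mul_sub, mul_neg, mul_one, sum_sub_distrib, sum_neg_distrib, mul_ite, mul_zero,
      sum_ite_eq', mem_univ, if_true] at this
    have h2 : e l * t = - ∑ l, e l := by
      rw [ht]
      field_simp [hlt.ne]
    linarith
  set E := ∑ l, e l with hE
  refine ⟨fun i => e (Sum.inl i) / E, fun j => e (Sum.inr j) / E,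
    fun i => div_nonneg (he _) hneg.le, fun j => div_nonneg (he _) hneg.le, ?_, fun x y => ?_⟩
  · rw [← sum_div, ← sum_div, ← add_div, ← Fintype.sum_sum_type]
    exact div_self hneg.ne'
  · have := hc0.trans (hfQ (q (x, y)) (subset_convexHull ℝ _ ⟨(x, y), rfl⟩))
    rw [hf, Fintype.sum_sum_type] at this
    simp only [q, Sum.elim_inl, Sum.elim_inr, mul_sub, sum_sub_distrib, ← sum_mul] at this
    have hE' : E = ∑ i, e (Sum.inl i) + ∑ j, e (Sum.inr j) := by
      rw [hE, Fintype.sum_sum_type]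
    have e1 : ∑ i, e (Sum.inl i) * (G * x i ^ 2) + ∑ j, e (Sum.inr j) * (G * y j ^ 2) =
        E * (G * (∑ i, e (Sum.inl i) / E * x i ^ 2 + ∑ j, e (Sum.inr j) / E * y j ^ 2)) := by
      simp only [mul_add, mul_sum]
      congr 1 <;>
      · refine sum_congr rfl fun _ _ => ?_
        field_simp
    refine le_of_mul_le_mul_left (a := E) ?_ hneg
    rw [← e1, hE', add_mul]
    simp only [form] at this
    linarith

/-- The squared Frobenius norm is at most the rank times the squared operator norm. -/
theorem sum_sq_le_rank_mul (C : Matrix I J ℝ) {K : ℝ} (hK : 0 < K)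
    (h : ∀ (x : I → ℝ) (y : J → ℝ), ∑ i, ∑ j, C i j * (x i * y j) ≤
      K * (∑ i, x i ^ 2 + ∑ j, y j ^ 2)) :
    ∑ i, ∑ j, C i j ^ 2 ≤ C.rank * (4 * K ^ 2) := by
  classical
  let V := LinearMap.range (Matrix.toEuclideanLin C)
  have hV : Module.finrank ℝ V = C.rank := by
    rw [Matrix.rank_eq_finrank_range_toLin C (PiLp.basisFun 2 ℝ I) (PiLp.basisFun 2 ℝ J)]
    rfl
  let e := stdOrthonormalBasis ℝ V
  let col : J → V := fun j => ⟨Matrix.toEuclideanLin C (EuclideanSpace.single j 1), ⟨_, rfl⟩⟩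
  have hcol (i : I) (j : J) : (col j : EuclideanSpace ℝ I) i = C i j := by
    simp [col, Matrix.toLpLin_apply]
  have hnorm (x : V) : ‖x‖ ^ 2 = ∑ i, (x : EuclideanSpace ℝ I) i ^ 2 := by
    rw [Submodule.coe_norm, EuclideanSpace.norm_sq_eq]
    simp
  have hinner (x y : V) : inner ℝ x y =
      ∑ i, (x : EuclideanSpace ℝ I) i * (y : EuclideanSpace ℝ I) i := by
    rw [Submodule.coe_inner, PiLp.inner_apply]
    simp [mul_comm]
  calc ∑ i, ∑ j, C i j ^ 2 = ∑ j, ‖col j‖ ^ 2 := by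
        rw [sum_comm]
        simp only [hnorm, hcol]
    _ = ∑ j, ∑ k, (inner ℝ (e k) (col j)) ^ 2 := by
        refine sum_congr rfl fun j _ => ?_
        rw [e.sum_sq_inner_right]
    _ = ∑ k, ∑ j, (inner ℝ (e k) (col j)) ^ 2 := sum_comm
    _ ≤ ∑ _k : Fin (Module.finrank ℝ V), 4 * K ^ 2 := by
        refine sum_le_sum fun k _ => ?_
        set τ := ∑ j, (inner ℝ (e k) (col j)) ^ 2 with hτ
        have h1 := h (fun i => (e k : EuclideanSpace ℝ I) i)
          (fun j => 1 / (2 * K) * inner ℝ (e k) (col j))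
        rw [← hnorm, e.norm_eq_one] at h1
        have h2 : ∑ i, ∑ j, C i j * ((e k : EuclideanSpace ℝ I) i *
            (1 / (2 * K) * inner ℝ (e k) (col j))) = 1 / (2 * K) * τ := by
          rw [sum_comm, hτ, mul_sum]
          refine sum_congr rfl fun j _ => ?_
          rw [pow_two]
          nth_rewrite 2 [hinner]
          rw [sum_mul, mul_sum]
          refine sum_congr rfl fun i _ => ?_
          rw [hcol]
          ring
        simp only [mul_pow, ← mul_sum] at h1
        rw [h2, ← hτ] at h1
        field_simp at h1
        nlinarith
    _ = C.rank * (4 * K ^ 2) := by simp [hV]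

/-- A bilinear form on the unit cubes is bounded by its extreme values on indicators. -/
theorem sum_mul_le_of_indicator {D : ℝ}
    (hD : ∀ (X : Finset I) (Y : Finset J), ∑ i ∈ X, ∑ j ∈ Y, B i j ≤ D)
    (x : I → ℝ) (y : J → ℝ) (hx0 : ∀ i, 0 ≤ x i) (hx1 : ∀ i, x i ≤ 1)
    (hy0 : ∀ j, 0 ≤ y j) (hy1 : ∀ j, y j ≤ 1) :
    ∑ i, ∑ j, B i j * (x i * y j) ≤ D := by
  classical
  have key {ι : Type} [Fintype ι] (z c : ι → ℝ) (h0 : ∀ i, 0 ≤ z i) (h1 : ∀ i, z i ≤ 1) :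
      ∑ i, z i * c i ≤ ∑ i with 0 < c i, c i := by
    rw [sum_filter]
    refine sum_le_sum fun i _ => ?_
    split_ifs with hc
    · nlinarith [h1 i]
    · nlinarith [h0 i]
  set X : Finset I := {i | 0 < ∑ j, B i j * y j}
  set Y : Finset J := {j | 0 < ∑ i ∈ X, B i j}
  calc ∑ i, ∑ j, B i j * (x i * y j) = ∑ i, x i * ∑ j, B i j * y j := by
        simp only [mul_sum]
        exact sum_congr rfl fun i _ => sum_congr rfl fun j _ => by ring
    _ ≤ ∑ i ∈ X, ∑ j, B i j * y j := key x _ hx0 hx1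
    _ = ∑ j, y j * ∑ i ∈ X, B i j := by
        rw [sum_comm]
        simp only [mul_sum, mul_comm]
    _ ≤ ∑ j ∈ Y, ∑ i ∈ X, B i j := key y _ hy0 hy1
    _ = ∑ i ∈ X, ∑ j ∈ Y, B i j := sum_comm
    _ ≤ D := hD X Y

theorem sum_mul_le_of_abs_le_one {D : ℝ}
    (hD : ∀ (X : Finset I) (Y : Finset J), |∑ i ∈ X, ∑ j ∈ Y, B i j| ≤ D)
    (x : I → ℝ) (y : J → ℝ) (hx : ∀ i, |x i| ≤ 1) (hy : ∀ j, |y j| ≤ 1) :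
    ∑ i, ∑ j, B i j * (x i * y j) ≤ 4 * D := by
  have hpos := sum_mul_le_of_indicator (B := B) (D := D) fun X Y => (abs_le.1 (hD X Y)).2
  have hneg := sum_mul_le_of_indicator (B := fun i j => -B i j) (D := D) fun X Y => by
    simp only [sum_neg_distrib]
    linarith [(abs_le.1 (hD X Y)).1]
  have p0 (t : ℝ) : 0 ≤ t⁺ := posPart_nonneg t
  have n0 (t : ℝ) : 0 ≤ t⁻ := negPart_nonneg t
  have p1 (t : ℝ) (ht : |t| ≤ 1) : t⁺ ≤ 1 := by
    linarith [posPart_add_negPart t, n0 t]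
  have n1 (t : ℝ) (ht : |t| ≤ 1) : t⁻ ≤ 1 := by
    linarith [posPart_add_negPart t, p0 t]
  have h1 := hpos (fun i => (x i)⁺) (fun j => (y j)⁺) (fun _ => p0 _) (fun i => p1 _ (hx i))
    (fun _ => p0 _) (fun j => p1 _ (hy j))
  have h2 := hpos (fun i => (x i)⁻) (fun j => (y j)⁻) (fun _ => n0 _) (fun i => n1 _ (hx i))
    (fun _ => n0 _) (fun j => n1 _ (hy j))
  have h3 := hneg (fun i => (x i)⁺) (fun j => (y j)⁻) (fun _ => p0 _) (fun i => p1 _ (hx i))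
    (fun _ => n0 _) (fun j => n1 _ (hy j))
  have h4 := hneg (fun i => (x i)⁻) (fun j => (y j)⁺) (fun _ => n0 _) (fun i => n1 _ (hx i))
    (fun _ => p0 _) (fun j => p1 _ (hy j))
  have e : ∑ i, ∑ j, B i j * (x i * y j) =
      ∑ i, ∑ j, B i j * ((x i)⁺ * (y j)⁺) + ∑ i, ∑ j, B i j * ((x i)⁻ * (y j)⁻) +
      ∑ i, ∑ j, -B i j * ((x i)⁺ * (y j)⁻) + ∑ i, ∑ j, -B i j * ((x i)⁻ * (y j)⁺) := by
    simp only [← sum_add_distrib]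
    refine sum_congr rfl fun i _ => sum_congr rfl fun j _ => ?_
    nth_rewrite 1 [← posPart_sub_negPart (x i), ← posPart_sub_negPart (y j)]
    ring
  linarith

/-- If the bilinear form of `B` has small cut norm, then `B` can be rescaled so that its
Frobenius norm is controlled by the rank. -/
theorem exists_weights_sum_sq_div_le [Nonempty I] [Nonempty J] (B : Matrix I J ℝ) {D : ℝ}
    (hD0 : 0 < D)
    (hD : ∀ (X : Finset I) (Y : Finset J), |∑ i ∈ X, ∑ j ∈ Y, B i j| ≤ D) :
    ∃ (a : I → ℝ) (b : J → ℝ), (∀ i, 0 < a i) ∧ (∀ j, 0 < b j) ∧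
      ∑ i, a i ≤ 2 ∧ ∑ j, b j ≤ 2 ∧
      ∑ i, ∑ j, B i j ^ 2 / (a i * b j) ≤ B.rank * (4096 * D ^ 2) := by
  classical
  have hGB : HilbertBilinearBound B (8 * (4 * D)) :=
    hilbertBilinearBound_of_sign (sum_mul_le_of_abs_le_one hD)
  obtain ⟨a, b, ha, hb, hab, h⟩ := hGB.exists_weights (by positivity)
  have hI : (0 : ℝ) < Fintype.card I := by exact_mod_cast Fintype.card_pos
  have hJ : (0 : ℝ) < Fintype.card J := by exact_mod_cast Fintype.card_pos
  have hsa := sum_nonneg fun i (_ : i ∈ univ) => ha i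
  have hsb := sum_nonneg fun j (_ : j ∈ univ) => hb j
  set a' : I → ℝ := fun i => a i + (Fintype.card I : ℝ)⁻¹ with ha'
  set b' : J → ℝ := fun j => b j + (Fintype.card J : ℝ)⁻¹ with hb'
  have pa (i : I) : 0 < a' i := add_pos_of_nonneg_of_pos (ha i) (inv_pos.2 hI)
  have pb (j : J) : 0 < b' j := add_pos_of_nonneg_of_pos (hb j) (inv_pos.2 hJ)
  refine ⟨a', b', pa, pb, ?_, ?_, ?_⟩
  · simp only [ha', sum_add_distrib, sum_const, card_univ, nsmul_eq_mul, mul_inv_cancel₀ hI.ne']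
    linarith
  · simp only [hb', sum_add_distrib, sum_const, card_univ, nsmul_eq_mul, mul_inv_cancel₀ hJ.ne']
    linarith
  let C : Matrix I J ℝ := Matrix.diagonal (fun i => (√(a' i))⁻¹) * B *
    Matrix.diagonal (fun j => (√(b' j))⁻¹)
  have hC (i : I) (j : J) : C i j = (√(a' i))⁻¹ * B i j * (√(b' j))⁻¹ := by
    simp [C, Matrix.mul_diagonal, Matrix.diagonal_mul]
  have hrank : C.rank ≤ B.rank :=
    (Matrix.rank_mul_le_left _ _).trans (Matrix.rank_mul_le_right _ _)
  have hCK := sum_sq_le_rank_mul C (K := 32 * D) (by positivity) fun x y => by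
    calc ∑ i, ∑ j, C i j * (x i * y j)
        = ∑ i, ∑ j, B i j * (((√(a' i))⁻¹ * x i) * ((√(b' j))⁻¹ * y j)) :=
          sum_congr rfl fun i _ => sum_congr rfl fun j _ => by
            rw [hC]
            ring
      _ ≤ 8 * (4 * D) * (∑ i, a i * ((√(a' i))⁻¹ * x i) ^ 2 +
            ∑ j, b j * ((√(b' j))⁻¹ * y j) ^ 2) := h _ _
      _ ≤ 8 * (4 * D) * (∑ i, x i ^ 2 + ∑ j, y j ^ 2) := by
          have key (s t z : ℝ) (ht : 0 < t) (hst : s ≤ t) : s * ((√t)⁻¹ * z) ^ 2 ≤ z ^ 2 := by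
            rw [mul_pow, inv_pow, Real.sq_sqrt ht.le, ← mul_assoc, ← div_eq_mul_inv]
            exact mul_le_of_le_one_left (sq_nonneg z) ((div_le_one ht).2 hst)
          have k1 (i : I) := key (a i) (a' i) (x i) (pa i) (by simp [ha'])
          have k2 (j : J) := key (b j) (b' j) (y j) (pb j) (by simp [hb'])
          gcongr with i _ j _
          · exact k1 i
          · exact k2 j
      _ = 32 * D * (∑ i, x i ^ 2 + ∑ j, y j ^ 2) := by ring
  calc ∑ i, ∑ j, B i j ^ 2 / (a' i * b' j) = ∑ i, ∑ j, C i j ^ 2 := by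
        refine sum_congr rfl fun i _ => sum_congr rfl fun j _ => ?_
        rw [hC, mul_pow, mul_pow, inv_pow, inv_pow, Real.sq_sqrt (pa i).le,
          Real.sq_sqrt (pb j).le]
        have := pa i
        have := pb j
        field_simp
    _ ≤ C.rank * (4 * (32 * D) ^ 2) := hCK
    _ = C.rank * (4096 * D ^ 2) := by ring
    _ ≤ B.rank * (4096 * D ^ 2) := by gcongr
end

theorem one_le_rank {m n : ℕ} {M : Matrix (Fin m) (Fin n) ℝ} (h : dens M ≠ 0) : 1 ≤ M.rank := by
  by_contra! hr
  have h0 : M = 0 := by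
    have hbot := Submodule.finrank_eq_zero.1 (Nat.lt_one_iff.1 hr)
    exact Matrix.toLin'.map_eq_zero_iff.1 (LinearMap.range_eq_bot.1 hbot)
  exact h (by simp [_root_.dens, ones, h0])

theorem rank_sub_const_le {m n : ℕ} (M : Matrix (Fin m) (Fin n) ℝ) (p : ℝ) :
    (Matrix.of fun i j => M i j - p).rank ≤ M.rank + 1 := by
  have e : (Matrix.of fun i j => M i j - p) =
      M + Matrix.vecMulVec (fun _ => -p) (fun _ => 1) := by
    ext i j
    simp [Matrix.vecMulVec_apply, sub_eq_add_neg]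
  rw [e]
  have hadd (A B : Matrix (Fin m) (Fin n) ℝ) : (A + B).rank ≤ A.rank + B.rank := by
    rw [Matrix.rank, Matrix.mulVecLin_add]
    exact (Submodule.finrank_mono (LinearMap.range_add_le _ _)).trans
      (Submodule.finrank_add_le_finrank_add_finrank _ _)
  exact (hadd _ _).trans (Nat.add_le_add_left (Matrix.rank_vecMulVec_le _ _) _)

theorem sum_sub_dens {m n : ℕ} (M : Matrix (Fin m) (Fin n) ℝ)
    (X : Finset (Fin m)) (Y : Finset (Fin n)) :
    ∑ i ∈ X, ∑ j ∈ Y, (M i j - dens M) = disc M X Y := by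
  simp [disc, ones, sum_sub_distrib]
  ring

/-- Few indices carry a weight much larger than average. -/
theorem card_heavy_le {n : ℕ} (hn : 0 < n) {a : Fin n → ℝ} (ha : ∀ i, 0 < a i)
    (hsum : ∑ i, a i ≤ 2) : ((#{i | ¬ a i * n ≤ 16} : ℕ) : ℝ) ≤ n / 8 := by
  have hn' : (0 : ℝ) < n := by exact_mod_cast hn
  have h1 : (#{i | ¬ a i * n ≤ 16} : ℝ) * (16 / n) ≤ ∑ i with ¬ a i * n ≤ 16, a i := by
    rw [← nsmul_eq_mul]
    refine card_nsmul_le_sum _ _ _ fun i hi => ?_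
    rw [div_le_iff₀ hn']
    exact (not_le.1 (mem_filter.1 hi).2).le
  have h2 : ∑ i with ¬ a i * n ≤ 16, a i ≤ ∑ i, a i :=
    sum_le_sum_of_subset_of_nonneg (filter_subset _ _) fun i _ _ => (ha i).le
  have h3 := (h1.trans h2).trans hsum
  rw [mul_div_assoc', div_le_iff₀ hn'] at h3
  linarith

/-- Lower bound for the rescaled Frobenius norm of `M - p` when all discrepancies are small. -/
theorem le_sum_sq_div {m n : ℕ} (hm : 0 < m) (hn : 0 < n) {M : Matrix (Fin m) (Fin n) ℝ}
    (hM : ∀ i j, M i j = 0 ∨ M i j = 1) (hp : 0 < dens M) (hp2 : dens M ≤ 1 / 2) {T : ℝ}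
    (hT : ∀ X Y, |disc M X Y| ≤ T) (hTp : T ≤ m * n * dens M / 1000)
    {a : Fin m → ℝ} {b : Fin n → ℝ} (ha : ∀ i, 0 < a i) (hb : ∀ j, 0 < b j)
    (hsa : ∑ i, a i ≤ 2) (hsb : ∑ j, b j ≤ 2) :
    (m * n : ℝ) ^ 2 * dens M / 80 ≤ ∑ i, ∑ j, (M i j - dens M) ^ 2 / (a i * b j) := by
  have hm' : (0 : ℝ) < m := by exact_mod_cast hm
  have hn' : (0 : ℝ) < n := by exact_mod_cast hn
  set p := dens M with hpdef
  let χ : Fin m → ℝ := fun i => if a i * m ≤ 16 then 1 else 0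
  let ψ : Fin n → ℝ := fun j => if b j * n ≤ 16 then 1 else 0
  have htotal : ∑ i, ∑ j, M i j = m * n * p := by
    rw [hpdef, _root_.dens, ones]
    field_simp
  have hrows : ∑ i, ∑ j, M i j * (1 - χ i) ≤ T + p * m * n / 8 := by
    have e : ∑ i, ∑ j, M i j * (1 - χ i) =
        disc M {i | ¬ a i * m ≤ 16} univ + p * #{i | ¬ a i * m ≤ 16} * n := by
      simp only [disc, ones, ← hpdef, card_univ, Fintype.card_fin, sub_add_cancel, sum_filter]
      refine sum_congr rfl fun i _ => ?_
      simp only [χ]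
      split_ifs <;> simp
    have := (abs_le.1 (hT {i | ¬ a i * m ≤ 16} univ)).2
    have hc : p * #{i | ¬ a i * m ≤ 16} * n ≤ p * (m / 8) * n := by
      have := card_heavy_le hm ha hsa
      gcongr
    linarith
  have hcols : ∑ i, ∑ j, M i j * (1 - ψ j) ≤ T + p * m * n / 8 := by
    have e : ∑ i, ∑ j, M i j * (1 - ψ j) =
        disc M univ {j | ¬ b j * n ≤ 16} + p * m * #{j | ¬ b j * n ≤ 16} := by
      simp only [disc, ones, ← hpdef, card_univ, Fintype.card_fin, sub_add_cancel, sum_filter]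
      refine sum_congr rfl fun i _ => sum_congr rfl fun j _ => ?_
      simp only [ψ]
      split_ifs <;> simp
    have := (abs_le.1 (hT univ {j | ¬ b j * n ≤ 16})).2
    have hc : p * m * #{j | ¬ b j * n ≤ 16} ≤ p * m * (n / 8) := by
      have := card_heavy_le hn hb hsb
      gcongr
    linarith
  have hlight : m * n * p / 2 ≤ ∑ i, ∑ j, M i j * (χ i * ψ j) := by
    have : ∑ i, ∑ j, M i j ≤ ∑ i, ∑ j, M i j * (χ i * ψ j) +
        ∑ i, ∑ j, M i j * (1 - χ i) + ∑ i, ∑ j, M i j * (1 - ψ j) := by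
      simp only [← sum_add_distrib]
      refine sum_le_sum fun i _ => sum_le_sum fun j _ => ?_
      simp only [χ, ψ]
      rcases hM i j with h | h <;> rw [h] <;> split_ifs <;> norm_num
    have hmnp : 0 ≤ m * n * p := by positivity
    linarith
  have hmass : ∑ i, ∑ j, M i j * ((χ i * a i) * (ψ j * b j)) ≤ 5 * p := by
    have h1 := sum_mul_le_of_indicator (B := fun i j => M i j - p) (D := T)
      (fun X Y => by
        rw [sum_sub_dens]
        exact (abs_le.1 (hT X Y)).2)
      (fun i => χ i * (a i * m / 16)) (fun j => ψ j * (b j * n / 16))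
      (fun i => by
        have := ha i
        simp only [χ]
        split_ifs <;> simp
        positivity)
      (fun i => by
        simp only [χ]
        split_ifs <;> simp
        linarith)
      (fun j => by
        have := hb j
        simp only [ψ]
        split_ifs <;> simp
        positivity)
      (fun j => by
        simp only [ψ]
        split_ifs <;> simp
        linarith)
    have e1 : ∑ i, ∑ j, (M i j - p) * (χ i * (a i * m / 16) * (ψ j * (b j * n / 16))) =
        (m * n / 256) * (∑ i, ∑ j, M i j * ((χ i * a i) * (ψ j * b j)) -
          p * ((∑ i, χ i * a i) * ∑ j, ψ j * b j)) := by
      rw [sum_mul_sum]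
      simp only [mul_sum, ← sum_sub_distrib]
      exact sum_congr rfl fun i _ => sum_congr rfl fun j _ => by ring
    have e2 : (∑ i, χ i * a i) * ∑ j, ψ j * b j ≤ 2 * 2 := by
      have k1 : ∑ i, χ i * a i ≤ ∑ i, a i := sum_le_sum fun i _ => by
        have := ha i
        simp only [χ]
        split_ifs <;> simp
        positivity
      have k2 : ∑ j, ψ j * b j ≤ ∑ j, b j := sum_le_sum fun j _ => by
        have := hb j
        simp only [ψ]
        split_ifs <;> simp
        positivity
      have k3 : 0 ≤ ∑ j, ψ j * b j := sum_nonneg fun j _ => by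
        have := hb j
        simp only [ψ]
        split_ifs <;> simp
        positivity
      exact mul_le_mul (k1.trans hsa) (k2.trans hsb) k3 (by norm_num)
    rw [e1] at h1
    have h2 : (m * n / 256 : ℝ) * (∑ i, ∑ j, M i j * ((χ i * a i) * (ψ j * b j)) -
          p * ((∑ i, χ i * a i) * ∑ j, ψ j * b j)) ≤ (m * n / 256) * p := by
      refine h1.trans (hTp.trans ?_)
      have : 0 ≤ m * n * p := by positivity
      linarith
    have h3 := le_of_mul_le_mul_left h2 (by positivity)
    nlinarith
  set l : ℝ := m * n / 10 with hl
  have hpoint (i : Fin m) (j : Fin n) :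
      l / 2 * (M i j * (χ i * ψ j)) - l ^ 2 / 4 * (M i j * ((χ i * a i) * (ψ j * b j))) ≤
        (M i j - p) ^ 2 / (a i * b j) := by
    have hab : 0 < a i * b j := mul_pos (ha i) (hb j)
    have hpos : 0 ≤ (M i j - p) ^ 2 / (a i * b j) := by positivity
    rcases hM i j with h | h
    · simpa [h] using hpos
    have key : l / 2 - l ^ 2 / 4 * (a i * b j) ≤ (M i j - p) ^ 2 / (a i * b j) := by
      rw [le_div_iff₀ hab, h]
      nlinarith [sq_nonneg (l * (a i * b j) - 1)]
    simp only [χ, ψ]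
    split_ifs
    · simpa [h] using key
    all_goals simpa using hpos
  calc (m * n : ℝ) ^ 2 * p / 80 = l / 2 * (m * n * p / 2) - l ^ 2 / 4 * (5 * p) := by
        rw [hl]
        ring
    _ ≤ l / 2 * (∑ i, ∑ j, M i j * (χ i * ψ j)) -
          l ^ 2 / 4 * ∑ i, ∑ j, M i j * ((χ i * a i) * (ψ j * b j)) := by
        gcongr
    _ = ∑ i, ∑ j, (l / 2 * (M i j * (χ i * ψ j)) -
          l ^ 2 / 4 * (M i j * ((χ i * a i) * (ψ j * b j)))) := by
        simp only [mul_sum, sum_sub_distrib]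
    _ ≤ _ := sum_le_sum fun i _ => sum_le_sum fun j _ => hpoint i j

/-- There is `c > 0` so that every binary `m×n` matrix of rank at most `r` and density
`p ≤ 1/2` satisfies `disc(M) ≥ c·mn·min{p, √p/√r}`. -/
theorem stmt9 :
    ∃ c : ℝ, 0 < c ∧
      ∀ (m n r : ℕ) (M : Matrix (Fin m) (Fin n) ℝ),
        (∀ i j, M i j = 0 ∨ M i j = 1) →
        M.rank ≤ r →
        dens M ≤ 1 / 2 →
        ∃ (X : Finset (Fin m)) (Y : Finset (Fin n)),
          |disc M X Y| ≥ c * (m * n) * min (dens M) (Real.sqrt (dens M) / Real.sqrt r) := by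
  refine ⟨1 / 1000, by norm_num, fun m n r M hM hr hp2 => ?_⟩
  rcases le_or_gt (dens M) 0 with hp | hp
  · refine ⟨∅, ∅, (mul_nonpos_of_nonneg_of_nonpos (by positivity)
      ((min_le_left _ _).trans hp)).trans (abs_nonneg _)⟩
  have hm : 0 < m := Nat.pos_of_ne_zero fun h => by
    subst h
    simp [_root_.dens] at hp
  have hn : 0 < n := Nat.pos_of_ne_zero fun h => by
    subst h
    simp [_root_.dens] at hp
  have hr1 : 1 ≤ r := (one_le_rank hp.ne').trans hr
  have hm' : (0 : ℝ) < m := by exact_mod_cast hm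
  have hn' : (0 : ℝ) < n := by exact_mod_cast hn
  have hr' : (1 : ℝ) ≤ r := by exact_mod_cast hr1
  have hr0 : (0 : ℝ) < r := by linarith
  have : Nonempty (Fin m) := ⟨⟨0, hm⟩⟩
  have : Nonempty (Fin n) := ⟨⟨0, hn⟩⟩
  by_contra! hcon
  set T : ℝ := 1 / 1000 * (m * n) * min (dens M) (√(dens M) / √r) with hTdef
  have hT0 : 0 < T := by
    have := Real.sqrt_pos.2 hp
    have := Real.sqrt_pos.2 hr0
    positivity
  have hT1 : T ≤ m * n * dens M / 1000 := by
    calc T ≤ 1 / 1000 * (m * n) * dens M := by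
          rw [hTdef]
          gcongr
          exact min_le_left _ _
      _ = _ := by ring
  have hT2 : T ≤ 1 / 1000 * (m * n) * (√(dens M) / √r) := by
    rw [hTdef]
    gcongr
    exact min_le_right _ _
  have hT3 : r * T ^ 2 ≤ (m * n) ^ 2 * dens M / 1000000 := by
    calc r * T ^ 2 ≤ r * (1 / 1000 * (m * n) * (√(dens M) / √r)) ^ 2 := by gcongr
      _ = _ := by
        rw [mul_pow, div_pow, Real.sq_sqrt hp.le, Real.sq_sqrt hr0.le]
        field_simp
        norm_num
  obtain ⟨a, b, ha, hb, hsa, hsb, hup⟩ :=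
    exists_weights_sum_sq_div_le (Matrix.of fun i j => M i j - dens M) hT0 fun X Y => by
      simp only [Matrix.of_apply, sum_sub_dens]
      exact (hcon X Y).le
  have hlow := le_sum_sq_div hm hn hM hp hp2 (fun X Y => (hcon X Y).le) hT1 ha hb hsa hsb
  have hrk : ((Matrix.of fun i j => M i j - dens M).rank : ℝ) ≤ 2 * r := by
    have := rank_sub_const_le M (dens M)
    exact_mod_cast (by omega : (Matrix.of fun i j => M i j - dens M).rank ≤ 2 * r)
  have hfin : (m * n : ℝ) ^ 2 * dens M / 80 ≤ 8192 * (r * T ^ 2) := by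
    calc _ ≤ _ := hlow
      _ ≤ _ := hup
      _ ≤ 2 * r * (4096 * T ^ 2) := by gcongr
      _ = _ := by ring
  have : 0 < (m * n : ℝ) ^ 2 * dens M := by positivity
  linarith
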